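/- arXiv:1211.5857 — 2 statements merged into one kernel-verified Lean document; each statement's English description precedes it below -/
import Mathlib

section
/- The water-filling allocation P_f = max(t − σ_f, 0), where t is the unique water level satisfying ∑_f max(t − σ_f, 0) = P_max, maximizes ∑_f log(1 + P_f/σ_f) over all P with P_f ≥ 0 and ∑_f P_f ≤ P_max. -/
theorem stmt_6 (N : ℕ) (hN : 0 < N) (σ : Fin N → ℝ) (hσ : ∀ f, 0 < σ f)
    (Pmax : ℝ) (hPmax : 0 < Pmax) (t : ℝ)
    (ht : ∑ f, max (t - σ f) 0 = Pmax) :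
    ∀ Q : Fin N → ℝ, (∀ f, 0 ≤ Q f) → ∑ f, Q f ≤ Pmax →
      ∑ f, Real.log (1 + Q f / σ f) ≤
        ∑ f, Real.log (1 + max (t - σ f) 0 / σ f) := by
  intro Q hQ hsum
  have htpos : 0 < t := by
    by_contra hcon
    have h0 : ∑ f, max (t - σ f) 0 = 0 :=
      Finset.sum_eq_zero fun f _ => max_eq_right (by linarith [hσ f])
    linarith
  have key : ∀ f, Real.log (1 + Q f / σ f) ≤
      Real.log (1 + max (t - σ f) 0 / σ f) + (Q f - max (t - σ f) 0) / t := by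
    intro f
    have hs := hσ f
    have hq := hQ f
    have hp : 0 ≤ max (t - σ f) 0 := le_max_right _ _
    have hle : (Q f - max (t - σ f) 0) / (σ f + max (t - σ f) 0)
        ≤ (Q f - max (t - σ f) 0) / t := by
      rcases le_total (t - σ f) 0 with h | h
      · rw [max_eq_right h, sub_zero, add_zero]
        exact div_le_div_of_nonneg_left hq htpos (by linarith)
      · rw [max_eq_left h, add_sub_cancel]
    generalize max (t - σ f) 0 = p at *
    have hA : 0 < 1 + Q f / σ f := by positivity
    have hB : 0 < 1 + p / σ f := by positivity
    have h1 := Real.log_le_sub_one_of_pos (div_pos hA hB)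
    rw [Real.log_div hA.ne' hB.ne'] at h1
    have h2 : (1 + Q f / σ f) / (1 + p / σ f) - 1 = (Q f - p) / (σ f + p) := by
      have : σ f + p ≠ 0 := by positivity
      field_simp
      ring
    linarith
  have h := Finset.sum_le_sum fun f (_ : f ∈ Finset.univ) => key f
  rw [Finset.sum_add_distrib, ← Finset.sum_div, Finset.sum_sub_distrib, ht] at h
  have : (∑ f, Q f - Pmax) / t ≤ 0 := div_nonpos_of_nonpos_of_nonneg (by linarith) htpos.le
  linarith
end

section
/- Existence of pure Nash equilibrium for a game with compact convex strategy sets and quasi-concave continuous utilities (Debreu–Fan–Glicksberg, specialized): Let each player i ∈ Ω have strategy set S_i ⊆ ℝ^N nonempty, compact, convex, and utility u_i continuous on ∏_j S_j and quasi-concave in its own variable. Then there exists a pure-strategy Nash equilibrium, i.e., P* ∈ ∏_j S_j with u_i(P_i*, P_{-i}*) ≥ u_i(P_i, P_{-i}*) for all i and all P_i ∈ S_i. -/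
namespace Scarf

open Finset

lemma collision {A B : Type*} [DecidableEq A] [DecidableEq B] (ρ : Finset A) (f : A → B)
    (h : ρ.card = (ρ.image f).card + 1) :
    ∃ x ∈ ρ, ∃ y ∈ ρ, x ≠ y ∧ f x = f y ∧
      ∀ z ∈ ρ, ∀ w ∈ ρ, f z = f w → z = w ∨ (z = x ∧ w = y) ∨ (z = y ∧ w = x) := by
  obtain ⟨x, hx, y, hy, hxy, hf⟩ := Finset.exists_ne_map_eq_of_card_lt_of_maps_to
    (s := ρ) (t := ρ.image f) (f := f) (by omega) (fun a ha => mem_image_of_mem f ha)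
  refine ⟨x, hx, y, hy, hxy, hf, ?_⟩
  have key : ∀ x ∈ ρ, ∀ y ∈ ρ, x ≠ y → f x = f y → Set.InjOn f (ρ.erase x : Finset A) := by
    intro x hx y hy hxy hf
    have him : (ρ.erase x).image f = ρ.image f := by
      ext b
      simp only [mem_image, mem_erase]
      constructor
      · rintro ⟨a, ⟨_, ha⟩, rfl⟩
        exact ⟨a, ha, rfl⟩
      · rintro ⟨a, ha, rfl⟩
        by_cases hax : a = x
        · exact ⟨y, ⟨hxy.symm, hy⟩, by rw [hax, hf]⟩
        · exact ⟨a, ⟨hax, ha⟩, rfl⟩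
    apply Finset.card_image_iff.mp
    rw [him, card_erase_of_mem hx]
    omega
  have k1 := key x hx y hy hxy hf
  have k2 := key y hy x hx hxy.symm hf.symm
  intro z hz w hw hzw
  have e1 : z ≠ x → w ≠ x → z = w := fun h1 h2 =>
    k1 (by simp [h1, hz]) (by simp [h2, hw]) hzw
  have e2 : z ≠ y → w ≠ y → z = w := fun h1 h2 =>
    k2 (by simp [h1, hz]) (by simp [h2, hw]) hzw
  by_cases a1 : z = x <;> by_cases a2 : w = x <;> by_cases a3 : z = y <;> by_cases a4 : w = y <;>
    simp_all

set_option linter.unusedSectionVars false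

variable {V I L : Type*} [DecidableEq V] [DecidableEq I] [Fintype V] [Fintype I] [LinearOrder L]

/-- dominating sets -/
def Dom (k : I → V → L) (ρ : Finset V) : Prop := ∀ y, ∃ i, ∀ x ∈ ρ, k i y ≤ k i x

lemma Dom.mono {k : I → V → L} {ρ τ : Finset V} (h : Dom k ρ) (hs : τ ⊆ ρ) : Dom k τ := by
  intro y
  obtain ⟨i, hi⟩ := h y
  exact ⟨i, fun x hx => hi x (hs hx)⟩

/-- the pivot in direction `a` -/
lemma pivot_exists (k : I → V → L) (τ : Finset V) (hd : Dom k τ)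
    (m : I → V) (hm : ∀ i, m i ∈ τ) (hmin : ∀ i, ∀ z ∈ τ, k i (m i) ≤ k i z)
    (hsurj : ∀ z ∈ τ, ∃ i, m i = z)
    (a b : I) (hab : a ≠ b) (hmab : m a = m b)
    (hM : ∃ y, ∀ j, j ≠ a → k j (m j) < k j y) :
    ∃ x, x ∉ τ ∧ (∀ j, j ≠ a → k j (m j) < k j x) ∧
      (∀ y, (∀ j, j ≠ a → k j (m j) < k j y) → k a y ≤ k a x) ∧ Dom k (insert x τ) := by
  classical
  obtain ⟨y0, hy0⟩ := hM
  obtain ⟨x, hxM, hx⟩ := Finset.exists_max_image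
    (univ.filter fun y => ∀ j, j ≠ a → k j (m j) < k j y) (k a) ⟨y0, by simpa using hy0⟩
  simp only [mem_filter, mem_univ, true_and] at hxM hx
  refine ⟨x, ?_, hxM, hx, ?_⟩
  · intro hxτ
    obtain ⟨j, hj⟩ := hsurj x hxτ
    by_cases hja : j = a
    · have := hxM b hab.symm
      rw [← hmab, ← hja, hj] at this
      exact lt_irrefl _ this
    · have := hxM j hja
      rw [hj] at this
      exact lt_irrefl _ this
  · have hxa : ∀ z ∈ τ, k a x ≤ k a z := by
      obtain ⟨i, hi⟩ := hd x
      by_cases hia : i = a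
      · rwa [hia] at hi
      · exact absurd (hi _ (hm i)) (not_le.mpr (hxM i hia))
    intro y
    by_cases hy : ∀ j, j ≠ a → k j (m j) < k j y
    · refine ⟨a, fun z hz => ?_⟩
      rcases mem_insert.mp hz with rfl | hz
      · exact hx y hy
      · exact (hx y hy).trans (hxa z hz)
    · push Not at hy
      obtain ⟨j, hja, hj⟩ := hy
      refine ⟨j, fun z hz => ?_⟩
      rcases mem_insert.mp hz with rfl | hz
      · exact hj.trans (hxM j hja).le
      · exact hj.trans (hmin j z hz)

lemma pivot_unique (k : I → V → L) (hk : ∀ i, Function.Injective (k i)) (τ : Finset V)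
    (m : I → V) (hm : ∀ i, m i ∈ τ) (hmin : ∀ i, ∀ z ∈ τ, k i (m i) ≤ k i z)
    (a b : I)
    (hcol : ∀ z w, m z = m w → z = w ∨ (z = a ∧ w = b) ∨ (z = b ∧ w = a))
    (x : V) (hx : x ∉ τ) (hd : Dom k (insert x τ)) :
    ∃ c, (c = a ∨ c = b) ∧ (∀ j, j ≠ c → k j (m j) < k j x) ∧
      (∀ y, (∀ j, j ≠ c → k j (m j) < k j y) → k c y ≤ k c x) := by
  obtain ⟨c, hc⟩ := hd x
  have hg : ∀ z ∈ τ, ∃ i, i ≠ c ∧ m i = z ∧ k i z < k i x := by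
    intro z hz
    obtain ⟨i, hi⟩ := hd z
    have hzx : z ≠ x := fun h => hx (h ▸ hz)
    have hlt : k i z < k i x := lt_of_le_of_ne (hi x (mem_insert_self _ _))
      (fun h => hzx (hk i h))
    refine ⟨i, ?_, ?_, hlt⟩
    · rintro rfl
      exact absurd (hc z (mem_insert_of_mem hz)) (not_le.mpr hlt)
    · exact hk i (le_antisymm (hmin i z hz) (hi _ (mem_insert_of_mem (hm i))))
  have hcab : c = a ∨ c = b := by
    obtain ⟨i, hic, hi, _⟩ := hg (m c) (hm c)
    rcases hcol i c hi with h | h | h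
    · exact absurd h hic
    · exact Or.inr h.2
    · exact Or.inl h.2
  have hM : ∀ j, j ≠ c → k j (m j) < k j x := by
    intro j hj
    obtain ⟨i, hic, hi, hlt⟩ := hg (m j) (hm j)
    have : i = j := by
      rcases hcol i j hi with h | h | h
      · exact h
      · rcases hcab with h' | h'
        · exact absurd (h.1.trans h'.symm) hic
        · exact absurd (h.2.trans h'.symm) hj
      · rcases hcab with h' | h'
        · exact absurd (h.2.trans h'.symm) hj
        · exact absurd (h.1.trans h'.symm) hic
    rwa [this] at hlt
  refine ⟨c, hcab, hM, ?_⟩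
  intro y hy
  obtain ⟨i, hi⟩ := hd y
  by_cases hic : i = c
  · rw [← hic]; exact hi x (mem_insert_self _ _)
  · exact absurd (hi (m i) (mem_insert_of_mem (hm i))) (not_le.mpr (hy i hic))

open Classical in
/-- a nonempty door with only good minima lies in exactly two rooms -/
lemma door_two (k : I → V → L) (hk : ∀ i, Function.Injective (k i)) (τ : Finset V)
    (hcard : Fintype.card I = τ.card + 1) (hd : Dom k τ) (hne : τ.Nonempty)
    (hM : ∀ m : I → V, (∀ i, m i ∈ τ) → (∀ i, ∀ z ∈ τ, k i (m i) ≤ k i z) →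
      ∀ a b, a ≠ b → m a = m b → ∃ y, ∀ j, j ≠ a → k j (m j) < k j y) :
    (univ.filter fun ρ : Finset V => ρ.card = Fintype.card I ∧ Dom k ρ ∧ τ ⊆ ρ).card = 2 := by
  have hex : ∀ i, ∃ x ∈ τ, ∀ z ∈ τ, k i x ≤ k i z := fun i => exists_min_image τ (k i) hne
  choose m hm hmin using hex
  have hsurj : ∀ z ∈ τ, ∃ i, m i = z := by
    intro z hz
    obtain ⟨i, hi⟩ := hd z
    exact ⟨i, hk i (le_antisymm (hmin i z hz) (hi _ (hm i)))⟩
  have him : (univ : Finset I).image m = τ := by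
    ext z
    simp only [mem_image, mem_univ, true_and]
    exact ⟨fun ⟨i, hi⟩ => hi ▸ hm i, hsurj z⟩
  obtain ⟨a, -, b, -, hab, hmab, hcol⟩ := collision (univ : Finset I) m
    (by rw [him, card_univ, hcard])
  have hcol' : ∀ z w, m z = m w → z = w ∨ (z = a ∧ w = b) ∨ (z = b ∧ w = a) :=
    fun z w h => hcol z (mem_univ _) w (mem_univ _) h
  obtain ⟨xa, hxa, hxaM, hxamax, hxad⟩ := pivot_exists k τ hd m hm hmin hsurj a b hab hmab
    (hM m hm hmin a b hab hmab)
  obtain ⟨xb, hxb, hxbM, hxbmax, hxbd⟩ := pivot_exists k τ hd m hm hmin hsurj b a hab.symm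
    hmab.symm (hM m hm hmin b a hab.symm hmab.symm)
  have hxab : xa ≠ xb := by
    rintro rfl
    obtain ⟨i, hi⟩ := hd xa
    by_cases hia : i = a
    · exact absurd (hi _ (hm i)) (not_le.mpr (hxbM i (hia ▸ hab)))
    · exact absurd (hi _ (hm i)) (not_le.mpr (hxaM i hia))
  rw [card_eq_two]
  refine ⟨insert xa τ, insert xb τ, ?_, ?_⟩
  · intro h
    have : xa ∈ insert xb τ := h ▸ mem_insert_self xa τ
    rcases mem_insert.mp this with h | h
    · exact hxab h
    · exact hxa h
  · ext ρ
    simp only [mem_filter, mem_univ, true_and, mem_insert, mem_singleton]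
    constructor
    · rintro ⟨hc, hdρ, hsub⟩
      obtain ⟨x, hx, rfl⟩ : ∃ x, x ∉ τ ∧ insert x τ = ρ := by
        have hc1 : (ρ \ τ).card = 1 := by
          rw [card_sdiff_of_subset hsub]; omega
        obtain ⟨x, hx⟩ := card_eq_one.mp hc1
        have hxm : x ∈ ρ \ τ := by rw [hx]; exact mem_singleton_self x
        refine ⟨x, (mem_sdiff.mp hxm).2, ?_⟩
        rw [← union_sdiff_of_subset hsub, hx, union_comm]; rfl
      obtain ⟨c, hcab, h1, h2⟩ := pivot_unique k hk τ m hm hmin a b hcol' x hx hdρ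
      rcases hcab with rfl | rfl
      · left
        rw [hk c (le_antisymm (hxamax x h1) (h2 xa hxaM))]
      · right
        rw [hk c (le_antisymm (hxbmax x h1) (h2 xb hxbM))]
    · rintro (rfl | rfl)
      · exact ⟨by rw [card_insert_of_notMem hxa, hcard], hxad, subset_insert _ _⟩
      · exact ⟨by rw [card_insert_of_notMem hxb, hcard], hxbd, subset_insert _ _⟩

open Classical in
lemma outer_one (k : I → V → L) (hk : ∀ i, Function.Injective (k i))
    (s : I → V) (hs : Function.Injective s)
    (hs1 : ∀ i v, k i (s i) ≤ k i v)
    (hs2 : ∀ i j, j ≠ i → ∀ v, v ∉ Set.range s → k i v < k i (s j))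
    (hV : ∃ v, v ∉ Set.range s) (i0 : I) :
    (univ.filter fun ρ : Finset V => ρ.card = Fintype.card I ∧ Dom k ρ ∧
      (univ.erase i0).image s ⊆ ρ).card = 1 := by
  set τ := (univ.erase i0).image s with hτ
  have hcard : Fintype.card I = τ.card + 1 := by
    rw [hτ, card_image_of_injective _ hs, card_erase_of_mem (mem_univ _), card_univ]
    have : 0 < Fintype.card I := Fintype.card_pos_iff.mpr ⟨i0⟩
    omega
  have hmem : ∀ j, j ≠ i0 → s j ∈ τ := fun j hj => mem_image_of_mem s (by simp [hj])
  have hmem' : ∀ z ∈ τ, ∃ j, j ≠ i0 ∧ s j = z := by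
    intro z hz
    simpa [hτ] using hz
  have hslt : ∀ i v, v ∉ Set.range s → k i (s i) < k i v := fun i v hv =>
    lt_of_le_of_ne (hs1 i v) (fun h => hv ⟨i, hk i h⟩)
  obtain ⟨v0, hv0⟩ := hV
  obtain ⟨x, hxM, hx⟩ := Finset.exists_max_image
    (univ.filter fun y => y ∉ Set.range s) (k i0) ⟨v0, by simpa using hv0⟩
  simp only [mem_filter, mem_univ, true_and] at hxM hx
  have hxτ : x ∉ τ := fun h => by
    obtain ⟨j, _, hj⟩ := hmem' x h
    exact hxM ⟨j, hj⟩
  rw [card_eq_one]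
  refine ⟨insert x τ, ?_⟩
  ext ρ
  simp only [mem_filter, mem_univ, true_and, mem_singleton]
  constructor
  · rintro ⟨hc, hdρ, hsub⟩
    obtain ⟨x', hx', rfl⟩ : ∃ x, x ∉ τ ∧ insert x τ = ρ := by
      have hc1 : (ρ \ τ).card = 1 := by
        rw [card_sdiff_of_subset hsub]; omega
      obtain ⟨x, hx⟩ := card_eq_one.mp hc1
      have hxm : x ∈ ρ \ τ := by rw [hx]; exact mem_singleton_self x
      refine ⟨x, (mem_sdiff.mp hxm).2, ?_⟩
      rw [← union_sdiff_of_subset hsub, hx, union_comm]; rfl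
    obtain ⟨i, hi⟩ := hdρ x
    have hii : i = i0 := by
      by_contra h
      exact absurd (hi (s i) (mem_insert_of_mem (hmem i h))) (not_le.mpr (hslt i x hxM))
    subst hii
    have hle := hi x' (mem_insert_self _ _)
    have hxr : x' ∉ Set.range s := by
      rintro ⟨j, rfl⟩
      by_cases hj : j = i
      · subst hj
        exact absurd hle (not_le.mpr (hslt j x hxM))
      · exact hx' (hmem j hj)
    rw [hk i (le_antisymm hle (hx x' hxr))]
  · rintro rfl
    refine ⟨by rw [card_insert_of_notMem hxτ, hcard], ?_, subset_insert _ _⟩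
    intro y
    by_cases hy : y ∈ Set.range s
    · obtain ⟨j, rfl⟩ := hy
      exact ⟨j, fun z _ => hs1 j z⟩
    · refine ⟨i0, fun z hz => ?_⟩
      rcases mem_insert.mp hz with rfl | hz
      · exact hx y hy
      · obtain ⟨j, hj, rfl⟩ := hmem' z hz
        exact (hs2 i0 j hj y hy).le

open Classical in
theorem scarf (k : I → V → L) (hk : ∀ i, Function.Injective (k i))
    (s : I → V) (hs : Function.Injective s)
    (hs1 : ∀ i v, k i (s i) ≤ k i v)
    (hs2 : ∀ i j, j ≠ i → ∀ v, v ∉ Set.range s → k i v < k i (s j))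
    (hV : ∃ v, v ∉ Set.range s) (i0 : I) (c : V → I) (hc : ∀ i, c (s i) = i) :
    ∃ ρ : Finset V, Dom k ρ ∧ ∀ i, ∃ x ∈ ρ, c x = i := by
  by_contra hcon
  push Not at hcon
  have hcardpos : 0 < Fintype.card I := Fintype.card_pos_iff.mpr ⟨i0⟩
  let rooms : Finset (Finset V) := univ.filter fun ρ => ρ.card = Fintype.card I ∧ Dom k ρ ∧
    ρ.image c = univ.erase i0
  let doors : Finset (Finset V) := univ.filter fun τ => Fintype.card I = τ.card + 1 ∧ Dom k τ ∧
    τ.image c = univ.erase i0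
  let τ0 : Finset V := (univ.erase i0).image s
  have hdc := sum_card_bipartiteAbove_eq_sum_card_bipartiteBelow
    (s := doors) (t := rooms) (r := fun τ ρ => τ ⊆ ρ)
  -- rooms above a door
  have habove : ∀ τ ∈ doors, bipartiteAbove (fun τ ρ => τ ⊆ ρ) rooms τ =
      univ.filter fun ρ : Finset V => ρ.card = Fintype.card I ∧ Dom k ρ ∧ τ ⊆ ρ := by
    intro τ hτ
    simp only [doors, mem_filter, mem_univ, true_and] at hτ
    ext ρ
    simp only [bipartiteAbove, rooms, mem_filter, mem_univ, true_and]
    constructor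
    · rintro ⟨⟨h1, h2, _⟩, h4⟩
      exact ⟨h1, h2, h4⟩
    · rintro ⟨h1, h2, h4⟩
      refine ⟨⟨h1, h2, ?_⟩, h4⟩
      have hsub : univ.erase i0 ⊆ ρ.image c := hτ.2.2 ▸ image_subset_image h4
      apply Subset.antisymm _ hsub
      intro j hj
      simp only [mem_erase, mem_univ, and_true]
      rintro rfl
      obtain ⟨i, hi⟩ := hcon ρ h2
      by_cases hij : i = j
      · subst hij
        obtain ⟨x, hx, hxi⟩ := mem_image.mp hj
        exact hi x hx hxi
      · obtain ⟨x, hx, hxi⟩ := mem_image.mp (hsub (mem_erase.mpr ⟨hij, mem_univ i⟩))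
        exact hi x hx hxi
  have hτ0 : τ0 ∈ doors := by
    simp only [doors, τ0, mem_filter, mem_univ, true_and]
    refine ⟨?_, ?_, ?_⟩
    · rw [card_image_of_injective _ hs, card_erase_of_mem (mem_univ _), card_univ]
      omega
    · intro y
      by_cases hy : y ∈ Set.range s
      · obtain ⟨j, rfl⟩ := hy
        exact ⟨j, fun z _ => hs1 j z⟩
      · refine ⟨i0, fun z hz => ?_⟩
        obtain ⟨j, hj, rfl⟩ := mem_image.mp hz
        exact (hs2 i0 j (mem_erase.mp hj).1 y hy).le
    · rw [image_image]
      have : c ∘ s = id := funext hc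
      rw [this, image_id]
  have hone : (bipartiteAbove (fun τ ρ => τ ⊆ ρ) rooms τ0).card = 1 := by
    rw [habove τ0 hτ0]
    exact outer_one k hk s hs hs1 hs2 hV i0
  have htwo : ∀ τ ∈ doors.erase τ0, (bipartiteAbove (fun τ ρ => τ ⊆ ρ) rooms τ).card = 2 := by
    intro τ hτ
    obtain ⟨hne0, hτd⟩ := mem_erase.mp hτ
    rw [habove τ hτd]
    simp only [doors, mem_filter, mem_univ, true_and] at hτd
    obtain ⟨h1, h2, h3⟩ := hτd
    have hsubr : ¬ (∀ z ∈ τ, z ∈ Set.range s) := by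
      intro hall
      apply hne0
      apply eq_of_subset_of_card_le
      · intro z hz
        obtain ⟨j, rfl⟩ := hall z hz
        have : c (s j) ∈ univ.erase i0 := h3 ▸ mem_image_of_mem c hz
        rw [hc] at this
        exact mem_image_of_mem s this
      · rw [card_image_of_injective _ hs, card_erase_of_mem (mem_univ _), card_univ]
        omega
    have hne : τ.Nonempty := by
      rw [nonempty_iff_ne_empty]
      rintro rfl
      exact hsubr (by simp)
    refine door_two k hk τ h1 h2 hne ?_
    intro m hm hmin a b hab hmab
    refine ⟨s a, fun j hj => ?_⟩
    by_cases hr : m j ∈ Set.range s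
    · obtain ⟨l, hl⟩ := hr
      by_cases hlj : l = j
      · subst hlj
        rw [← hl]
        exact lt_of_le_of_ne (hs1 l _) (fun h => hj (hs (hk l h)))
      · exfalso
        apply hsubr
        intro z hz
        by_contra hzr
        have := hs2 j l hlj z hzr
        rw [hl] at this
        exact absurd (hmin j z hz) (not_le.mpr this)
    · exact hs2 j a (Ne.symm hj) _ hr
  have hbelow : ∀ ρ ∈ rooms, (bipartiteBelow (fun τ ρ => τ ⊆ ρ) doors ρ).card = 2 := by
    intro ρ hρ
    simp only [rooms, mem_filter, mem_univ, true_and] at hρ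
    obtain ⟨h1, h2, h3⟩ := hρ
    obtain ⟨x, hx, y, hy, hxy, hcxy, hcol⟩ := collision ρ c (by
      rw [h3, card_erase_of_mem (mem_univ _), card_univ, h1]; omega)
    have hdoor : ∀ x ∈ ρ, ∀ y ∈ ρ, x ≠ y → c x = c y → ρ.erase x ∈ doors := by
      intro x hx y hy hxy hcxy
      simp only [doors, mem_filter, mem_univ, true_and]
      refine ⟨by rw [card_erase_of_mem hx]; omega, h2.mono (erase_subset _ _), ?_⟩
      rw [← h3]
      apply Subset.antisymm (image_subset_image (erase_subset _ _))
      intro j hj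
      obtain ⟨z, hz, rfl⟩ := mem_image.mp hj
      by_cases hzx : z = x
      · rw [hzx, hcxy]
        exact mem_image_of_mem c (mem_erase.mpr ⟨hxy.symm, hy⟩)
      · exact mem_image_of_mem c (mem_erase.mpr ⟨hzx, hz⟩)
    rw [card_eq_two]
    refine ⟨ρ.erase x, ρ.erase y, ?_, ?_⟩
    · intro h
      have : x ∈ ρ.erase y := mem_erase.mpr ⟨hxy, hx⟩
      rw [← h] at this
      exact (mem_erase.mp this).1 rfl
    · ext τ
      simp only [bipartiteBelow, mem_filter, mem_insert, mem_singleton]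
      constructor
      · rintro ⟨hτ, hsub⟩
        simp only [doors, mem_filter, mem_univ, true_and] at hτ
        obtain ⟨g1, g2, g3⟩ := hτ
        have hc1 : (ρ \ τ).card = 1 := by
          rw [card_sdiff_of_subset hsub]; omega
        obtain ⟨z, hz⟩ := card_eq_one.mp hc1
        have hzm : z ∈ ρ \ τ := by rw [hz]; exact mem_singleton_self z
        obtain ⟨hzρ, hzτ⟩ := mem_sdiff.mp hzm
        have hτe : τ = ρ.erase z := by
          rw [← sdiff_singleton_eq_erase, ← hz, Finset.sdiff_sdiff_eq_self hsub]
        have : c z ∈ τ.image c := by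
          rw [g3, ← h3]; exact mem_image_of_mem c hzρ
        obtain ⟨w, hw, hwz⟩ := mem_image.mp this
        rcases hcol z hzρ w (hsub hw) hwz.symm with h | h | h
        · exact absurd (h ▸ hw) hzτ
        · left; rw [hτe, h.1]
        · right; rw [hτe, h.1]
      · rintro (rfl | rfl)
        · exact ⟨hdoor x hx y hy hxy hcxy, erase_subset _ _⟩
        · exact ⟨hdoor y hy x hx hxy.symm hcxy.symm, erase_subset _ _⟩
  rw [← add_sum_erase _ _ hτ0, hone, sum_congr rfl htwo, sum_congr rfl hbelow] at hdc
  simp only [sum_const, smul_eq_mul] at hdc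
  omega

end Scarf

namespace Scarf

open Finset

lemma grid {I : Type*} [Fintype I] [DecidableEq I] (i0 : I) (N : ℕ) (c : (I → ℕ) → I) :
    ∃ (σ : Finset (I → ℕ)) (C : Finset I), C.Nonempty ∧ σ.Nonempty ∧ (∀ x ∈ σ, ∑ i, x i = N) ∧
      (∀ y : I → ℕ, ∑ i, y i = N → ∃ i ∈ C, ∀ x ∈ σ, y i ≤ x i) ∧ ∀ i ∈ C, ∃ x ∈ σ, c x = i := by
  classical
  let T := {x : I → ℕ // x ∈ Finset.piAntidiag (univ : Finset I) N}
  have hT : ∀ t : T, ∑ i, t.1 i = N := fun t => (mem_piAntidiag.mp t.2).1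
  let mk : ∀ y : I → ℕ, ∑ i, y i = N → T := fun y hy => ⟨y, mem_piAntidiag.mpr ⟨hy, by simp⟩⟩
  have hle : ∀ (t : T) i, t.1 i ≤ N := fun t i => by
    exact (single_le_sum (f := t.1) (fun _ _ => Nat.zero_le _) (mem_univ i)).trans (hT t).le
  let M := Fintype.card T
  let e : T → ℕ := fun t => (Fintype.equivFin T t : ℕ)
  have heM : ∀ t, e t < M := fun t => (Fintype.equivFin T t).2
  have hei : ∀ t t', e t = e t' → t = t' := fun t t' h =>
    (Fintype.equivFin T).injective (Fin.ext h)
  let e' : I → ℕ := fun t => (Fintype.equivFin I t : ℕ)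
  have hei' : ∀ t t', e' t = e' t' → t = t' := fun t t' h =>
    (Fintype.equivFin I).injective (Fin.ext h)
  let k : I → T ⊕ I → ℕ := fun i v => Sum.elim (fun t : T => 1 + (t.1 i * M + e t))
    (fun j => if j = i then 0 else 2 + N * M + M + e' j) v
  have hkl : ∀ i (t : T), k i (Sum.inl t) = 1 + (t.1 i * M + e t) := fun _ _ => rfl
  have hkr : ∀ i j, k i (Sum.inr j) = if j = i then 0 else 2 + N * M + M + e' j := fun _ _ => rfl
  have hbd : ∀ i (t : T), k i (Sum.inl t) < 1 + N * M + M := by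
    intro i t
    rw [hkl]
    have := Nat.mul_le_mul_right M (hle t i)
    have := heM t
    omega
  have hmono : ∀ i (t t' : T), k i (Sum.inl t) ≤ k i (Sum.inl t') → t.1 i ≤ t'.1 i := by
    intro i t t' h
    rw [hkl, hkl] at h
    by_contra hlt
    push Not at hlt
    have := Nat.mul_le_mul_right M (Nat.succ_le_of_lt hlt)
    rw [Nat.succ_mul] at this
    have := heM t'
    omega
  have hk : ∀ i, Function.Injective (k i) := by
    intro i v w h
    rcases v with t | j <;> rcases w with t' | j'
    · have h1 := hmono i t t' h.le
      have h2 := hmono i t' t h.ge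
      rw [hkl, hkl, le_antisymm h1 h2] at h
      rw [hei t t' (by omega)]
    · have := hbd i t
      rw [h, hkr] at this
      rw [hkl, hkr] at h
      split_ifs at h this <;> omega
    · have := hbd i t'
      rw [← h, hkr] at this
      rw [hkl, hkr] at h
      split_ifs at h this <;> omega
    · rw [hkr, hkr] at h
      split_ifs at h with h1 h2 h2
      · rw [h1, h2]
      · omega
      · omega
      · rw [hei' j j' (by omega)]
  have ht0 : ∑ i, (Pi.single i0 N : I → ℕ) i = N := by simp
  obtain ⟨ρ, hd, hcol⟩ := scarf k hk Sum.inr Sum.inr_injective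
    (by intro i v; rw [hkr, if_pos rfl]; exact Nat.zero_le _)
    (by
      intro i j hj v hv
      rcases v with t | l
      · have := hbd i t
        rw [hkr, if_neg hj]; omega
      · exact absurd ⟨l, rfl⟩ hv)
    ⟨Sum.inl (mk _ ht0), by simp⟩ i0 (Sum.elim (fun t => c t.1) id) (fun i => rfl)
  let σ : Finset (I → ℕ) := (univ.filter fun t : T => Sum.inl t ∈ ρ).image Subtype.val
  let C : Finset I := univ.filter fun i => Sum.inr i ∉ ρ
  have hσ : ∀ x, x ∈ σ ↔ ∃ t : T, Sum.inl t ∈ ρ ∧ t.1 = x := by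
    intro x
    simp only [σ, mem_image, mem_filter, mem_univ, true_and]
    exact Iff.rfl
  have hdom : ∀ y : I → ℕ, ∑ i, y i = N → ∃ i ∈ C, ∀ x ∈ σ, y i ≤ x i := by
    intro y hy
    obtain ⟨i, hi⟩ := hd (Sum.inl (mk y hy))
    refine ⟨i, ?_, ?_⟩
    · simp only [C, mem_filter, mem_univ, true_and]
      intro h
      have := hi _ h
      rw [hkl, hkr, if_pos rfl] at this
      omega
    · intro x hx
      obtain ⟨t, ht, rfl⟩ := (hσ x).mp hx
      exact hmono i _ _ (hi _ ht)
  have hcolC : ∀ i ∈ C, ∃ x ∈ σ, c x = i := by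
    intro i hi
    simp only [C, mem_filter, mem_univ, true_and] at hi
    obtain ⟨x, hx, hxi⟩ := hcol i
    rcases x with t | j
    · exact ⟨t.1, (hσ _).mpr ⟨t, hx, rfl⟩, hxi⟩
    · have : j = i := hxi
      exact absurd (this ▸ hx) hi
  obtain ⟨i, hi, _⟩ := hdom _ ht0
  obtain ⟨x, hx, _⟩ := hcolC i hi
  refine ⟨σ, C, ⟨i, hi⟩, ⟨x, hx⟩, ?_, hdom, hcolC⟩
  intro x hx
  obtain ⟨t, _, rfl⟩ := (hσ x).mp hx
  exact hT t

/-- The combinatorial estimate on the small cell. -/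
lemma grid' {I : Type*} [Fintype I] [DecidableEq I] (i0 : I) (N : ℕ) (c : (I → ℕ) → I) :
    ∃ z : I → ℕ, ∑ i, z i = N ∧ ∀ i, z i ≤ Fintype.card I ∨
      ∃ x : I → ℕ, ∑ i, x i = N ∧ c x = i ∧
        ∀ j, x j ≤ z j + Fintype.card I ∧ z j ≤ x j + Fintype.card I := by
  classical
  obtain ⟨σ, C, hC, hσ, hsum, hdom, hcol⟩ := grid i0 N c
  have hex : ∀ i, ∃ x ∈ σ, ∀ z ∈ σ, x i ≤ z i := fun i => exists_min_image σ (fun x => x i) hσ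
  choose m hm hmin using hex
  have hbig : N < ∑ i ∈ C, (m i i + 1) := by
    by_contra hle
    push Not at hle
    obtain ⟨j, hj⟩ := hC
    let y : I → ℕ := fun i => (if i ∈ C then m i i + 1 else 0) +
      (if i = j then N - ∑ i ∈ C, (m i i + 1) else 0)
    have hy : ∑ i, y i = N := by
      simp only [y, sum_add_distrib, sum_ite_eq', sum_ite_mem, univ_inter, mem_univ, if_true]
      rw [← sum_add_distrib]
      omega
    obtain ⟨i, hi, h⟩ := hdom y hy
    have := h _ (hm i)
    simp only [y, if_pos hi] at this
    omega
  have hCc : C.card ≤ Fintype.card I := card_le_univ C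
  rw [sum_add_distrib, sum_const, smul_eq_mul, mul_one] at hbig
  -- coordinates of points of σ
  have hin : ∀ x ∈ σ, ∀ i ∈ C, m i i ≤ x i ∧ x i ≤ m i i + Fintype.card I := by
    intro x hx i hi
    refine ⟨hmin i x hx, ?_⟩
    have h1 : ∑ i ∈ C, x i ≤ N := by
      rw [← hsum x hx]; exact sum_le_sum_of_subset (subset_univ C)
    rw [← add_sum_erase C _ hi] at h1 hbig
    have h2 : ∑ l ∈ C.erase i, m l l ≤ ∑ l ∈ C.erase i, x l := sum_le_sum fun l _ => hmin l x hx
    omega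
  have hout : ∀ x ∈ σ, ∀ i, i ∉ C → x i ≤ Fintype.card I := by
    intro x hx i hi
    have h1 : ∑ l ∈ insert i C, x l ≤ N := by
      rw [← hsum x hx]; exact sum_le_sum_of_subset (subset_univ _)
    rw [sum_insert hi] at h1
    have h2 : ∑ l ∈ C, m l l ≤ ∑ l ∈ C, x l := sum_le_sum fun l _ => hmin l x hx
    omega
  obtain ⟨z, hz⟩ := hσ
  refine ⟨z, hsum z hz, fun i => ?_⟩
  by_cases hi : i ∈ C
  · right
    obtain ⟨x, hx, hxi⟩ := hcol i hi
    refine ⟨x, hsum x hx, hxi, fun j => ?_⟩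
    by_cases hj : j ∈ C
    · have := hin x hx j hj
      have := hin z hz j hj
      omega
    · have := hout x hx j hj
      have := hout z hz j hj
      omega
  · exact Or.inl (hout z hz i hi)

theorem brouwer_approx {I : Type*} [Fintype I] [Nonempty I] (f : (I → ℝ) → (I → ℝ))
    (hf : ContinuousOn f (stdSimplex ℝ I)) (hmaps : ∀ x ∈ stdSimplex ℝ I, f x ∈ stdSimplex ℝ I)
    (ε : ℝ) (hε : 0 < ε) : ∃ z ∈ stdSimplex ℝ I, ∀ i, z i ≤ f z i + ε := by
  classical
  have huc := (isCompact_stdSimplex ℝ I).uniformContinuousOn_of_continuous hf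
  rw [Metric.uniformContinuousOn_iff] at huc
  obtain ⟨δ, hδ, hδf⟩ := huc (ε / 2) (by positivity)
  set n : ℝ := (Fintype.card I : ℝ) with hn
  obtain ⟨N, hN⟩ := exists_nat_gt (n / min δ (ε / 2))
  have hmin : 0 < min δ (ε / 2) := lt_min hδ (by positivity)
  have hn0 : 0 ≤ n := Nat.cast_nonneg _
  have hNpos : (0 : ℝ) < N := lt_of_le_of_lt (by positivity) hN
  have hsmall : n / N < min δ (ε / 2) := by
    rw [div_lt_iff₀ hmin] at hN
    rw [div_lt_iff₀ hNpos]; linarith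
  let g : (I → ℕ) → (I → ℝ) := fun x i => (x i : ℝ) / N
  have hg : ∀ x : I → ℕ, ∑ i, x i = N → g x ∈ stdSimplex ℝ I := by
    intro x hx
    refine ⟨fun i => by positivity, ?_⟩
    simp only [g]
    rw [← sum_div, ← Nat.cast_sum, hx, div_self hNpos.ne']
  have hcex : ∀ x : I → ℕ, ∃ i, ∑ i, x i = N → g x i ≤ f (g x) i := by
    intro x
    by_cases hx : ∑ i, x i = N
    · have h1 := hg x hx
      have h2 := hmaps _ h1
      obtain ⟨i, _, hi⟩ := Finset.exists_le_of_sum_le (s := univ) (f := g x) (g := f (g x))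
        univ_nonempty (by rw [h1.2, h2.2])
      exact ⟨i, fun _ => hi⟩
    · exact ⟨Classical.arbitrary I, fun h => absurd h hx⟩
  choose c hc using hcex
  obtain ⟨z, hz, hzi⟩ := grid' (Classical.arbitrary I) N c
  have hzΔ := hg z hz
  refine ⟨g z, hzΔ, fun i => ?_⟩
  rcases hzi i with h | ⟨x, hx, hxi, hclose⟩
  · have h1 : g z i ≤ n / N := by
      simp only [g]
      gcongr
      rw [hn]; exact_mod_cast h
    have h2 := (hmaps _ hzΔ).1 i
    have := min_le_right δ (ε / 2)
    linarith
  · have hcl : ∀ j, |g x j - g z j| ≤ n / N := by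
      intro j
      obtain ⟨a, b⟩ := hclose j
      have a' : (x j : ℝ) ≤ z j + n := by rw [hn]; exact_mod_cast a
      have b' : (z j : ℝ) ≤ x j + n := by rw [hn]; exact_mod_cast b
      simp only [g]
      rw [← sub_div, abs_div, abs_of_pos hNpos]
      gcongr
      rw [abs_le]; constructor <;> linarith
    have hdist : dist (g x) (g z) < δ := by
      refine lt_of_le_of_lt ?_ (lt_of_lt_of_le hsmall (min_le_left _ _))
      rw [dist_pi_le_iff (by positivity)]
      intro j
      rw [Real.dist_eq]; exact hcl j
    have h1 := hδf _ (hg x hx) _ hzΔ hdist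
    have h2 : |f (g x) i - f (g z) i| < ε / 2 := by
      rw [← Real.dist_eq]; exact lt_of_le_of_lt (dist_le_pi_dist _ _ i) h1
    have h3 := hc x hx
    rw [hxi] at h3
    have h4 := hcl i
    have := min_le_right δ (ε / 2)
    rw [abs_lt] at h2
    rw [abs_le] at h4
    linarith [h2.1, h2.2, h4.1, h4.2]

theorem brouwer_simplex {I : Type*} [Fintype I] [Nonempty I] (f : (I → ℝ) → (I → ℝ))
    (hf : ContinuousOn f (stdSimplex ℝ I)) (hmaps : ∀ x ∈ stdSimplex ℝ I, f x ∈ stdSimplex ℝ I) :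
    ∃ z ∈ stdSimplex ℝ I, f z = z := by
  classical
  have hfi : ∀ i, ContinuousOn (fun z => f z i) (stdSimplex ℝ I) := fun i =>
    (continuous_apply i).comp_continuousOn hf
  have hcont : ContinuousOn (fun z => ∑ i, max 0 (z i - f z i)) (stdSimplex ℝ I) := by
    refine continuousOn_finsetSum _ fun i _ => ?_
    exact (continuous_const.max continuous_id).comp_continuousOn
      ((continuous_apply i).continuousOn.sub (hfi i))
  obtain ⟨z1, hz1, _⟩ := brouwer_approx f hf hmaps 1 one_pos
  obtain ⟨z, hz, hzmin⟩ := (isCompact_stdSimplex ℝ I).exists_isMinOn ⟨z1, hz1⟩ hcont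
  have hle : ∑ i, max 0 (z i - f z i) ≤ 0 := by
    refine le_of_forall_pos_le_add fun ε hε => ?_
    have hn : (0 : ℝ) < Fintype.card I := by exact_mod_cast Fintype.card_pos
    obtain ⟨w, hw, hwi⟩ := brouwer_approx f hf hmaps (ε / Fintype.card I) (by positivity)
    have h1 : ∑ i, max 0 (z i - f z i) ≤ ∑ i, max 0 (w i - f w i) := hzmin hw
    have h2 : ∑ i, max 0 (w i - f w i) ≤ ∑ _i : I, ε / Fintype.card I := by
      refine sum_le_sum fun i _ => max_le (by positivity) ?_
      linarith [hwi i]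
    rw [sum_const, card_univ, nsmul_eq_mul, mul_div_cancel₀ _ hn.ne'] at h2
    linarith
  have hi : ∀ i, z i ≤ f z i := by
    intro i
    have h0 := single_le_sum (f := fun i => max 0 (z i - f z i))
      (fun _ _ => le_max_left _ _) (mem_univ i)
    have := le_max_right 0 (z i - f z i)
    linarith
  refine ⟨z, hz, ?_⟩
  have hs : ∑ i, z i = ∑ i, f z i := by rw [hz.2, (hmaps z hz).2]
  have := (sum_eq_sum_iff_of_le (fun i _ => hi i)).mp hs
  funext i
  exact (this i (mem_univ i)).symm

theorem schauder {E : Type*} [NormedAddCommGroup E] [NormedSpace ℝ E] (X : Set E)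
    (hne : X.Nonempty) (hX : IsCompact X) (hcv : Convex ℝ X) (f : E → E)
    (hf : ContinuousOn f X) (hmaps : ∀ x ∈ X, f x ∈ X) : ∃ x ∈ X, f x = x := by
  classical
  have happ : ∀ ε > 0, ∃ x ∈ X, ‖x - f x‖ ≤ ε := by
    intro ε hε
    obtain ⟨t, htX, htf, hcov⟩ := hX.finite_cover_balls hε
    have : Fintype t := htf.fintype
    have htne : Nonempty t := by
      obtain ⟨x, hx⟩ := hne
      obtain ⟨v, hv, _⟩ := Set.mem_iUnion₂.mp (hcov hx)
      exact ⟨⟨v, hv⟩⟩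
    let φ : t → E → ℝ := fun v x => max 0 (ε - dist x v)
    have hφ0 : ∀ v x, 0 ≤ φ v x := fun v x => le_max_left _ _
    have hφc : ∀ v, Continuous (φ v) := fun v => by fun_prop
    have hpos : ∀ x ∈ X, 0 < ∑ v, φ v x := by
      intro x hx
      obtain ⟨v, hv, hxv⟩ := Set.mem_iUnion₂.mp (hcov hx)
      refine sum_pos' (fun v _ => hφ0 v x) ⟨⟨v, hv⟩, mem_univ _, ?_⟩
      exact lt_max_of_lt_right (sub_pos.mpr (Metric.mem_ball.mp hxv))
    let p : (t → ℝ) → E := fun l => ∑ v : t, l v • (v : E)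
    have hp : Continuous p := by fun_prop
    have hpX : ∀ l ∈ stdSimplex ℝ t, p l ∈ X := fun l hl =>
      hcv.sum_mem (fun v _ => hl.1 v) hl.2 (fun v _ => htX v.2)
    let G : (t → ℝ) → (t → ℝ) := fun l v => φ v (f (p l)) / ∑ w, φ w (f (p l))
    have hfp : ContinuousOn (fun l => f (p l)) (stdSimplex ℝ t) :=
      hf.comp hp.continuousOn hpX
    have hG : ContinuousOn G (stdSimplex ℝ t) := by
      refine continuousOn_pi.mpr fun v => ?_
      refine ContinuousOn.div ((hφc v).comp_continuousOn hfp)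
        (continuousOn_finsetSum _ fun w _ => (hφc w).comp_continuousOn hfp) ?_
      intro l hl
      exact (hpos _ (hmaps _ (hpX l hl))).ne'
    have hGm : ∀ l ∈ stdSimplex ℝ t, G l ∈ stdSimplex ℝ t := by
      intro l hl
      have := hpos _ (hmaps _ (hpX l hl))
      refine ⟨fun v => div_nonneg (hφ0 _ _) this.le, ?_⟩
      simp only [G]
      rw [← sum_div, div_self this.ne']
    obtain ⟨l, hl, hGl⟩ := brouwer_simplex G hG hGm
    refine ⟨p l, hpX l hl, ?_⟩
    have h1 : p l - f (p l) = ∑ v : t, l v • ((v : E) - f (p l)) := by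
      simp only [smul_sub, sum_sub_distrib]
      rw [← sum_smul, hl.2, one_smul]
    rw [h1]
    calc ‖∑ v : t, l v • ((v : E) - f (p l))‖ ≤ ∑ v : t, ‖l v • ((v : E) - f (p l))‖ :=
          norm_sum_le _ _
      _ ≤ ∑ v : t, l v * ε := by
          refine sum_le_sum fun v _ => ?_
          rw [norm_smul, Real.norm_of_nonneg (hl.1 v)]
          by_cases h0 : l v = 0
          · simp [h0]
          · refine mul_le_mul_of_nonneg_left ?_ (hl.1 v)
            by_contra hlt
            push Not at hlt
            apply h0
            have : φ v (f (p l)) = 0 := by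
              apply max_eq_left
              rw [dist_comm, dist_eq_norm]; linarith
            rw [← hGl]
            simp only [G, this, zero_div]
      _ = ε := by rw [← sum_mul, hl.2, one_mul]
  obtain ⟨x, hx, hmin⟩ := hX.exists_isMinOn hne (continuousOn_id.sub hf).norm
  refine ⟨x, hx, ?_⟩
  have : ‖x - f x‖ ≤ 0 := by
    refine le_of_forall_pos_le_add fun ε hε => ?_
    obtain ⟨w, hw, hwε⟩ := happ ε hε
    have h1 : ‖x - f x‖ ≤ ‖w - f w‖ := hmin hw
    linarith
  exact (sub_eq_zero.mp (norm_le_zero_iff.mp this)).symm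

end Scarf

theorem stmt_19 (N : ℕ) {ι : Type*} [DecidableEq ι] [Fintype ι]
    (S : ι → Set (EuclideanSpace ℝ (Fin N)))
    (hne : ∀ i, (S i).Nonempty) (hcpt : ∀ i, IsCompact (S i))
    (hcvx : ∀ i, Convex ℝ (S i))
    (u : ι → ((i : ι) → EuclideanSpace ℝ (Fin N)) → ℝ)
    (hcont : ∀ i, ContinuousOn (u i) (Set.pi Set.univ S))
    (hqc : ∀ i (P : (i : ι) → EuclideanSpace ℝ (Fin N)) (τ : ℝ),
      Convex ℝ {x | x ∈ S i ∧ τ ≤ u i (Function.update P i x)}) :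
    ∃ Pstar ∈ Set.pi Set.univ S,
      ∀ i, ∀ x ∈ S i, u i (Function.update Pstar i x) ≤ u i Pstar := by
  classical
  by_contra hcon
  push Not at hcon
  set X : Set (ι → EuclideanSpace ℝ (Fin N)) := Set.pi Set.univ S with hXdef
  have hXne : X.Nonempty := Set.univ_pi_nonempty_iff.mpr hne
  have hXc : IsCompact X := isCompact_univ_pi hcpt
  have hXv : Convex ℝ X := convex_pi fun i _ => hcvx i
  have hex : ∀ P : ι → EuclideanSpace ℝ (Fin N), ∃ q : ι × EuclideanSpace ℝ (Fin N),
      P ∈ X → q.2 ∈ S q.1 ∧ u q.1 P < u q.1 (Function.update P q.1 q.2) := by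
    intro P
    by_cases hP : P ∈ X
    · obtain ⟨i, x, hx, h⟩ := hcon P hP
      exact ⟨(i, x), fun _ => ⟨hx, h⟩⟩
    · obtain ⟨P0, hP0⟩ := hXne
      obtain ⟨i, x, _, _⟩ := hcon P0 hP0
      exact ⟨(i, x), fun h => absurd h hP⟩
  choose q hq using hex
  let d : (ι → EuclideanSpace ℝ (Fin N)) → (ι → EuclideanSpace ℝ (Fin N)) → ℝ := fun p Q =>
    u (q p).1 (Function.update Q (q p).1 (q p).2) - u (q p).1 Q
  have hupd : ∀ Q ∈ X, ∀ i, ∀ x ∈ S i, Function.update Q i x ∈ X := by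
    intro Q hQ i x hx j _
    by_cases hj : j = i
    · subst hj; simpa using hx
    · rw [Function.update_of_ne hj]; exact hQ j trivial
  have hdc : ∀ p ∈ X, ContinuousOn (d p) X := by
    intro p hp
    refine ContinuousOn.sub ?_ (hcont _)
    refine (hcont _).comp (t := X) ?_ (fun Q hQ => hupd Q hQ _ _ (hq p hp).1)
    exact (continuous_id.update _ continuous_const).continuousOn
  obtain ⟨t, htX, hcov⟩ := hXc.elim_nhdsWithin_subcover (fun p => {Q | 0 < d p Q}) (by
    intro p hp
    exact (hdc p hp p hp).eventually (lt_mem_nhds (sub_pos.mpr (hq p hp).2)))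
  let g : (ι → EuclideanSpace ℝ (Fin N)) → (ι → EuclideanSpace ℝ (Fin N)) → ℝ := fun p Q =>
    max 0 (d p Q)
  have hg0 : ∀ p Q, 0 ≤ g p Q := fun p Q => le_max_left _ _
  have hgc : ∀ p ∈ X, ContinuousOn (g p) X := fun p hp =>
    (continuous_const.max continuous_id).comp_continuousOn (hdc p hp)
  let A : ι → Finset (ι → EuclideanSpace ℝ (Fin N)) := fun i => t.filter fun p => (q p).1 = i
  have hA : ∀ i, ∀ p ∈ A i, p ∈ X ∧ (q p).1 = i := fun i p hp =>
    ⟨htX p (Finset.mem_filter.mp hp).1, (Finset.mem_filter.mp hp).2⟩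
  let G : ι → (ι → EuclideanSpace ℝ (Fin N)) → ℝ := fun i Q => ∑ p ∈ A i, g p Q
  have hG0 : ∀ i Q, 0 ≤ G i Q := fun i Q => Finset.sum_nonneg fun p _ => hg0 p Q
  let f : (ι → EuclideanSpace ℝ (Fin N)) → (ι → EuclideanSpace ℝ (Fin N)) := fun Q i =>
    (1 + G i Q)⁻¹ • (Q i + ∑ p ∈ A i, g p Q • (q p).2)
  have hfc : ContinuousOn f X := by
    refine continuousOn_pi.mpr fun i => ?_
    have c1 : ContinuousOn (fun Q => 1 + G i Q) X :=
      continuousOn_const.add (continuousOn_finsetSum _ fun p hp => hgc p (hA i p hp).1)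
    have c2 : ContinuousOn (fun Q => (1 + G i Q)⁻¹) X := by
      refine c1.inv₀ fun Q _ => ?_
      have := hG0 i Q
      positivity
    have c3 : ContinuousOn (fun Q : ι → EuclideanSpace ℝ (Fin N) => Q i) X :=
      (continuous_apply i).continuousOn
    have c4 : ContinuousOn (fun Q => ∑ p ∈ A i, g p Q • (q p).2) X :=
      continuousOn_finsetSum _ fun p hp => (hgc p (hA i p hp).1).smul continuousOn_const
    exact c2.smul (c3.add c4)
  have hfm : ∀ Q ∈ X, f Q ∈ X := by
    intro Q hQ i _
    have hG := hG0 i Q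
    by_cases hz : G i Q = 0
    · have hall : ∀ p ∈ A i, g p Q = 0 :=
        (Finset.sum_eq_zero_iff_of_nonneg fun p _ => hg0 p Q).mp hz
      have : ∑ p ∈ A i, g p Q • (q p).2 = 0 :=
        Finset.sum_eq_zero fun p hp => by rw [hall p hp, zero_smul]
      simp only [f, hz, this, add_zero, inv_one, one_smul]
      exact hQ i trivial
    · have hpos : 0 < G i Q := lt_of_le_of_ne hG (Ne.symm hz)
      have hmem : (A i).centerMass (fun p => g p Q) (fun p => (q p).2) ∈ S i :=
        (hcvx i).centerMass_mem (fun p _ => hg0 p Q) hpos (fun p hp => by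
          have := (hq p (hA i p hp).1).1
          rwa [(hA i p hp).2] at this)
      have h1 := hcvx i (hQ i trivial) hmem (a := (1 + G i Q)⁻¹) (b := (1 + G i Q)⁻¹ * G i Q)
        (by positivity) (by positivity) (by field_simp)
      convert h1 using 1
      simp only [f, Finset.centerMass, smul_add, smul_smul]
      congr 2
      change _ = (1 + G i Q)⁻¹ * G i Q * (G i Q)⁻¹
      field_simp
  obtain ⟨Q, hQ, hfQ⟩ := Scarf.schauder X hXne hXc hXv f hfc hfm
  obtain ⟨p0, hp0, hd0⟩ := Set.mem_iUnion₂.mp (hcov hQ)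
  have hd0' : 0 < d p0 Q := hd0
  set i := (q p0).1 with hi
  have hp0A : p0 ∈ A i := Finset.mem_filter.mpr ⟨hp0, rfl⟩
  let B := (A i).filter fun p => 0 < d p Q
  have hp0B : p0 ∈ B := Finset.mem_filter.mpr ⟨hp0A, hd0'⟩
  have hzero : ∀ p ∈ A i, p ∉ B → g p Q = 0 := by
    intro p hp hpB
    apply max_eq_left
    by_contra h
    exact hpB (Finset.mem_filter.mpr ⟨hp, not_le.mp h⟩)
  have hBsum : ∑ p ∈ B, g p Q = G i Q :=
    Finset.sum_subset (Finset.filter_subset _ _) hzero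
  have hBsum' : ∑ p ∈ B, g p Q • (q p).2 = ∑ p ∈ A i, g p Q • (q p).2 :=
    Finset.sum_subset (Finset.filter_subset _ _) fun p hp hpB => by
      rw [hzero p hp hpB, zero_smul]
  have hGpos : 0 < G i Q :=
    Finset.sum_pos' (fun p _ => hg0 p Q) ⟨p0, hp0A, lt_max_of_lt_right hd0'⟩
  have hfix : ∑ p ∈ A i, g p Q • (q p).2 = G i Q • Q i := by
    have h1 : (1 + G i Q)⁻¹ • (Q i + ∑ p ∈ A i, g p Q • (q p).2) = Q i := congrFun hfQ i
    rw [inv_smul_eq_iff₀ (by positivity), add_smul, one_smul] at h1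
    exact add_left_cancel h1
  obtain ⟨p1, hp1, hmin⟩ := B.exists_min_image
    (fun p => u i (Function.update Q i (q p).2)) ⟨p0, hp0B⟩
  have hcm : B.centerMass (fun p => g p Q) (fun p => (q p).2) = Q i := by
    rw [Finset.centerMass, hBsum, hBsum', hfix, inv_smul_smul₀ hGpos.ne']
  have hmem := (hqc i Q (u i (Function.update Q i (q p1).2))).centerMass_mem (t := B)
    (w := fun p => g p Q) (z := fun p => (q p).2) (fun p _ => hg0 p Q) (by rw [hBsum]; exact hGpos)
    (fun p hp => by
      have hpA := hA i p (Finset.mem_filter.mp hp).1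
      have h1 := (hq p hpA.1).1
      rw [hpA.2] at h1
      exact ⟨h1, hmin p hp⟩)
  rw [hcm] at hmem
  have h2 := hmem.2
  rw [Function.update_eq_self] at h2
  obtain ⟨hp1A, hp1d⟩ := Finset.mem_filter.mp hp1
  have h3 : 0 < u (q p1).1 (Function.update Q (q p1).1 (q p1).2) - u (q p1).1 Q := hp1d
  rw [(hA i p1 hp1A).2] at h3
  linarith
end
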